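/- Let p ∈ ℝ^{d_p} and q ∈ ℝ^{d_q} be probability distributions with H(p) > 0, H(q) > 0, V(p) > 0 and V(q) > 0, and let s denote a sharp distribution. Let (t_n) be a moderate sequence and set ε_n = e^{−n t_n²}. For ε ≥ 0 define the optimal entanglement-direction conversion rate R_n^{ent}(ε) = (1/n)·sup{ m ∈ ℕ : p^{⊗n} ⊗ s^{⊗m} ≺_ε q^{⊗m} ⊗ s^{⊗n} }, where ≺_ε is approximate majorisation with total variation error. Set ν = (V(p)/H(p)) / (V(q)/H(q)). Then lim_{n→∞} ( R_n^{ent}(ε_n) − H(p)/H(q) ) / t_n = −(√(2 V(p)) / H(q)) · |1 − 1/√ν|. -/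

import Mathlib

open Finset Filter Real Topology

noncomputable section

/-- A probability distribution on a finite type: nonnegative entries summing to 1. -/
def IsProbDist {α : Type*} [Fintype α] (a : α → ℝ) : Prop :=
  (∀ i, 0 ≤ a i) ∧ ∑ i, a i = 1

/-- A sharp distribution: a single entry equal to 1, all others 0. -/
def IsSharp {α : Type*} [Fintype α] (a : α → ℝ) : Prop :=
  ∃ i, a i = 1 ∧ ∀ j, j ≠ i → a j = 0

/-- The uniform distribution: all entries equal to `1 / |α|`. -/
def IsUniform {α : Type*} [Fintype α] (a : α → ℝ) : Prop :=
  ∀ i, a i = 1 / (Fintype.card α : ℝ)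

/-- Tensor (Kronecker) product of two vectors. -/
def tensor {α β : Type*} (a : α → ℝ) (b : β → ℝ) : α × β → ℝ :=
  fun x => a x.1 * b x.2

/-- `n`-fold tensor power of a vector. -/
def tpow {α : Type*} (a : α → ℝ) (n : ℕ) : (Fin n → α) → ℝ :=
  fun f => ∏ j, a (f j)

/-- Shannon entropy (natural logarithm, with the convention `0 · ln 0 = 0`). -/
def shannonH {α : Type*} [Fintype α] (a : α → ℝ) : ℝ :=
  -∑ i, a i * Real.log (a i)

/-- Entropy variance `V(a) = ∑ i, a i (ln a i + H(a))²`. -/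
def entV {α : Type*} [Fintype α] (a : α → ℝ) : ℝ :=
  ∑ i, a i * (Real.log (a i) + shannonH a) ^ 2

/-- Relative entropy `D(a‖b)`. -/
def relD {α : Type*} [Fintype α] (a b : α → ℝ) : ℝ :=
  ∑ i, a i * Real.log (a i / b i)

/-- Relative entropy variance `V(a‖b)`. -/
def relV {α : Type*} [Fintype α] (a b : α → ℝ) : ℝ :=
  ∑ i, a i * (Real.log (a i / b i) - relD a b) ^ 2

/-- Total variation distance. -/
def tvd {α : Type*} [Fintype α] (a b : α → ℝ) : ℝ :=
  (1 / 2) * ∑ i, |a i - b i|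

/-- Fidelity `F(a,b) = (∑ i √(a i · b i))²`. -/
def fid {α : Type*} [Fintype α] (a b : α → ℝ) : ℝ :=
  (∑ i, Real.sqrt (a i * b i)) ^ 2

/-- The entries of `a` sorted in non-increasing order, as a vector on `Fin (card α)`. -/
def descSorted {α : Type*} [Fintype α] (a : α → ℝ) : Fin (Fintype.card α) → ℝ :=
  fun i =>
    a ((Fintype.equivFin α).symm
      (Tuple.sort (fun j => -a ((Fintype.equivFin α).symm j)) i))

/-- `headSum a K = ∑_{1 ≤ i ≤ K} a^↓_i` (1-based indices `i`, comparison `(i : ℝ) ≤ K`,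
equivalently `i ≤ ⌊K⌋`). -/
def headSum {α : Type*} [Fintype α] (a : α → ℝ) (K : ℝ) : ℝ :=
  ∑ i ∈ Finset.univ.filter (fun i : Fin (Fintype.card α) => ((i : ℕ) + 1 : ℝ) ≤ K),
    descSorted a i

/-- `tailSum a K = ∑_{i ≥ K} a^↓_i` (1-based indices `i`, comparison `K ≤ (i : ℝ)`,
equivalently `i ≥ ⌈K⌉`). -/
def tailSum {α : Type*} [Fintype α] (a : α → ℝ) (K : ℝ) : ℝ :=
  ∑ i ∈ Finset.univ.filter (fun i : Fin (Fintype.card α) => K ≤ ((i : ℕ) + 1 : ℝ)),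
    descSorted a i

/-- `a` majorises `b` (written `a ≻ b`): every partial sum of the non-increasingly sorted
`a` dominates the corresponding partial sum of sorted `b` (shorter vectors padded with zeros). -/
def Maj {α β : Type*} [Fintype α] [Fintype β] (a : α → ℝ) (b : β → ℝ) : Prop :=
  ∀ j : ℕ, headSum b (j : ℝ) ≤ headSum a (j : ℝ)

/-- `a ≻_ε b`: approximate majorisation (from above) with total variation error:
there is a probability distribution `b̃` with `a ≻ b̃` and `δ(b, b̃) ≤ ε`. -/
def ApproxMajTV {α β : Type*} [Fintype α] [Fintype β] (a : α → ℝ) (b : β → ℝ) (ε : ℝ) : Prop :=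
  ∃ bt : β → ℝ, IsProbDist bt ∧ Maj a bt ∧ tvd b bt ≤ ε

/-- `a ≺_ε b`: approximate majorisation (from below) with total variation error:
there is a probability distribution `b̃` with `a ≺ b̃` and `δ(b, b̃) ≤ ε`. -/
def ApproxSubMajTV {α β : Type*} [Fintype α] [Fintype β] (a : α → ℝ) (b : β → ℝ) (ε : ℝ) : Prop :=
  ∃ bt : β → ℝ, IsProbDist bt ∧ Maj bt a ∧ tvd b bt ≤ ε

/-- A moderate sequence: `t n → 0` and `√n · t n → +∞`. -/
def ModerateSeq (t : ℕ → ℝ) : Prop :=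
  Tendsto t atTop (𝓝 0) ∧ Tendsto (fun n : ℕ => Real.sqrt (n : ℝ) * t n) atTop atTop

/-- The uniform distribution on `Fin d`. -/
def unif (d : ℕ) : Fin d → ℝ := fun _ => 1 / (d : ℝ)

/-- The embedding map `Γ` associated with `γ_i = c_i / N`: for each `i` it produces
`c_i` entries equal to `a_i / c_i`. -/
def embed {d : ℕ} (c : Fin d → ℕ) (a : Fin d → ℝ) : (Σ i : Fin d, Fin (c i)) → ℝ :=
  fun x => a x.1 / (c x.1 : ℝ)

/-- Cut-and-pile modification of the sorted version of `a`, with cut at `K`: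
the first entry absorbs the total mass of entries at (1-based) positions `≥ K`,
entries at positions `1 < i < K` are unchanged, and entries at positions `≥ K` are set to 0. -/
def cutAndPile {α : Type*} [Fintype α] (a : α → ℝ) (K : ℝ) : Fin (Fintype.card α) → ℝ :=
  fun i =>
    if (i : ℕ) = 0 then descSorted a i + tailSum a K
    else if ((i : ℕ) + 1 : ℝ) < K then descSorted a i else 0

/-- The enumeration of the outcomes of `a` by non-increasing weight. -/
def descEquiv {α : Type*} [Fintype α] (a : α → ℝ) : Fin (Fintype.card α) ≃ α :=
  (Tuple.sort (fun j => -a ((Fintype.equivFin α).symm j))).trans (Fintype.equivFin α).symm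

lemma descSorted_eq {α : Type*} [Fintype α] (a : α → ℝ) (i : Fin (Fintype.card α)) :
    descSorted a i = a (descEquiv a i) := rfl

lemma descSorted_antitone {α : Type*} [Fintype α] (a : α → ℝ) : Antitone (descSorted a) := by
  intro i j hij
  have h := Tuple.monotone_sort (fun j => -a ((Fintype.equivFin α).symm j)) hij
  simpa [descSorted] using h

lemma card_filter_succ_le (N : ℕ) {K : ℝ} (hK : 0 ≤ K) :
    ((Finset.univ.filter (fun i : Fin N => ((i : ℕ) + 1 : ℝ) ≤ K)).card : ℝ) ≤ K := by
  have h1 : (Finset.univ.filter (fun i : Fin N => ((i : ℕ) + 1 : ℝ) ≤ K)).card ≤ ⌊K⌋₊ := by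
    rw [← Finset.card_range ⌊K⌋₊]
    refine Finset.card_le_card_of_injOn (fun i => (i : ℕ)) ?_ (fun i _ j _ h => Fin.ext h)
    intro i hi
    have hi' : ((i : ℕ) + 1 : ℝ) ≤ K := by simpa using hi
    simp only [Finset.coe_range, Set.mem_Iio]
    exact Nat.le_floor (by exact_mod_cast hi')
  exact le_trans (by exact_mod_cast h1) (Nat.floor_le hK)

lemma exists_headSum_eq {α : Type*} [Fintype α] (a : α → ℝ) {K : ℝ} (hK : 0 ≤ K) :
    ∃ T : Finset α, (T.card : ℝ) ≤ K ∧ headSum a K = ∑ i ∈ T, a i := by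
  refine ⟨(Finset.univ.filter
    (fun i : Fin (Fintype.card α) => ((i : ℕ) + 1 : ℝ) ≤ K)).map (descEquiv a).toEmbedding, ?_, ?_⟩
  · rw [Finset.card_map]
    exact card_filter_succ_le _ hK
  · rw [Finset.sum_map]
    rfl

/-- The sum over any set of at most `K` outcomes is at most the head sum. -/
lemma sum_le_headSum {α : Type*} [Fintype α] {a : α → ℝ} (ha : ∀ i, 0 ≤ a i) {K : ℝ}
    (T : Finset α) (hT : (T.card : ℝ) ≤ K) : ∑ i ∈ T, a i ≤ headSum a K := by
  set J := Finset.univ.filter (fun i : Fin (Fintype.card α) => ((i : ℕ) + 1 : ℝ) ≤ K) with hJ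
  set T' : Finset (Fin (Fintype.card α)) := T.map (descEquiv a).symm.toEmbedding with hT'
  have hsum : ∑ i ∈ T, a i = ∑ i ∈ T', descSorted a i := by
    rw [hT', Finset.sum_map]
    simp [descSorted_eq]
  have hcardT : T'.card = T.card := by rw [hT', Finset.card_map]
  have hd0 : ∀ i, 0 ≤ descSorted a i := fun i => ha _
  rw [hsum]
  change _ ≤ ∑ i ∈ J, descSorted a i
  have e1 := Finset.sum_inter_add_sum_sdiff T' J (descSorted a)
  have e2 := Finset.sum_inter_add_sum_sdiff J T' (descSorted a)
  rw [Finset.inter_comm J T'] at e2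
  suffices h : ∑ i ∈ T' \ J, descSorted a i ≤ ∑ i ∈ J \ T', descSorted a i by linarith
  rcases (T' \ J).eq_empty_or_nonempty with h0 | hne
  · rw [h0, Finset.sum_empty]
    exact Finset.sum_nonneg (fun i _ => hd0 i)
  obtain ⟨j, hj, hmax⟩ := Finset.exists_max_image (T' \ J) (descSorted a) hne
  have hjJ : K < (j : ℕ) + 1 := by
    have := (Finset.mem_sdiff.1 hj).2
    simpa [hJ] using this
  have hcardJ : T'.card ≤ J.card := by
    have hTj : T.card ≤ (j : ℕ) := by
      have : (T.card : ℝ) < ((j : ℕ) + 1 : ℕ) := by push_cast; linarith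
      have := Nat.cast_lt.1 this
      omega
    rw [hcardT, ← Finset.card_range T.card]
    have hN : ∀ i ∈ Finset.range T.card, i < Fintype.card α := fun i hi =>
      lt_of_lt_of_le (Finset.mem_range.1 hi) (hTj.trans j.2.le)
    refine Finset.card_le_card_of_injOn
      (fun i => if h : i < Fintype.card α then ⟨i, h⟩ else j) ?_ ?_
    · intro i hi
      have hi1 := hN i (by simpa using hi)
      have hi2 : i + 1 ≤ T.card := by simpa using hi
      have hi3 : ((i : ℝ) + 1) ≤ T.card := by exact_mod_cast hi2
      simp only [hi1, dif_pos, hJ, Finset.coe_filter, Set.mem_ofPred_eq, Finset.mem_univ, true_and]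
      linarith
    · intro i hi i' hi' h
      have hi1 := hN i (by simpa using hi)
      have hi1' := hN i' (by simpa using hi')
      simpa [hi1, hi1'] using h
  have hcard : (T' \ J).card ≤ (J \ T').card := by
    have c1 := Finset.card_sdiff_add_card_inter T' J
    have c2 := Finset.card_sdiff_add_card_inter J T'
    rw [Finset.inter_comm J T'] at c2
    omega
  calc ∑ i ∈ T' \ J, descSorted a i ≤ (T' \ J).card • descSorted a j :=
        Finset.sum_le_card_nsmul _ _ _ hmax
    _ ≤ (J \ T').card • descSorted a j := nsmul_le_nsmul_left (hd0 j) hcard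
    _ ≤ ∑ i ∈ J \ T', descSorted a i := by
        refine Finset.card_nsmul_le_sum _ _ _ fun i hi => descSorted_antitone a ?_
        have hi' : ((i : ℕ) + 1 : ℝ) ≤ K := by
          have := (Finset.mem_sdiff.1 hi).1
          simpa [hJ] using this
        have : ((i : ℕ) : ℝ) < (j : ℕ) := by linarith
        exact Fin.le_def.2 (by exact_mod_cast this.le)

lemma headSum_mono {α : Type*} [Fintype α] {a : α → ℝ} (ha : ∀ i, 0 ≤ a i) {K K' : ℝ}
    (h : K ≤ K') : headSum a K ≤ headSum a K' := by
  refine Finset.sum_le_sum_of_subset_of_nonneg (fun i hi => ?_) (fun i _ _ => ha _)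
  simp only [Finset.mem_filter, Finset.mem_univ, true_and] at hi ⊢
  exact hi.trans h

lemma headSum_floor {α : Type*} [Fintype α] (a : α → ℝ) {K : ℝ} (hK : 0 ≤ K) :
    headSum a K = headSum a (⌊K⌋₊ : ℝ) := by
  unfold headSum
  congr 1
  ext i
  simp only [Finset.mem_filter, Finset.mem_univ, true_and]
  have := Nat.le_floor_iff hK (n := (i : ℕ) + 1)
  push_cast at this
  rw [← this]
  norm_cast

lemma headSum_nonneg {α : Type*} [Fintype α] {a : α → ℝ} (ha : ∀ i, 0 ≤ a i) (K : ℝ) :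
    0 ≤ headSum a K :=
  Finset.sum_nonneg (fun _ _ => ha _)

lemma headSum_le_one {α : Type*} [Fintype α] {a : α → ℝ} (ha : IsProbDist a) (K : ℝ) :
    headSum a K ≤ 1 := by
  rw [← ha.2, ← Equiv.sum_comp (descEquiv a) a]
  exact Finset.sum_le_sum_of_subset_of_nonneg (Finset.subset_univ _) (fun _ _ _ => ha.1 _)

/-- Coarse-graining along `g` can only increase head sums. -/
lemma headSum_le_of_map {α β : Type*} [Fintype α] [Fintype β] [DecidableEq α]
    {a : α → ℝ} {b : β → ℝ}
    (ha : ∀ i, 0 ≤ a i) (hb : ∀ i, 0 ≤ b i) (g : β → α)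
    (hg : ∀ i, ∑ x ∈ Finset.univ.filter (fun x => g x = i), b x ≤ a i) {K : ℝ} (hK : 0 ≤ K) :
    headSum b K ≤ headSum a K := by
  obtain ⟨T, hT, hTs⟩ := exists_headSum_eq b hK
  rw [hTs]
  refine le_trans ?_ (sum_le_headSum ha (T.image g)
    (le_trans (by exact_mod_cast Finset.card_image_le) hT))
  rw [← Finset.sum_fiberwise_of_maps_to (fun x hx => Finset.mem_image_of_mem g hx)]
  refine Finset.sum_le_sum fun i _ => le_trans ?_ (hg i)
  refine Finset.sum_le_sum_of_subset_of_nonneg (fun x hx => ?_) (fun x _ _ => hb x)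
  simp only [Finset.mem_filter, Finset.mem_univ, true_and] at hx ⊢
  exact hx.2

lemma headSum_tensor_sharp {α β : Type*} [Fintype α] [Fintype β] {a : α → ℝ} {b : β → ℝ}
    (ha : ∀ i, 0 ≤ a i) (hb : IsSharp b) {K : ℝ} (hK : 0 ≤ K) :
    headSum (tensor a b) K = headSum a K := by
  classical
  obtain ⟨j, hj, hj0⟩ := hb
  have hb0 : ∀ i, 0 ≤ b i := fun i => by
    by_cases h : i = j
    · rw [h, hj]; exact zero_le_one
    · rw [hj0 i h]
  have ht0 : ∀ x, 0 ≤ tensor a b x := fun x => mul_nonneg (ha _) (hb0 _)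
  apply le_antisymm
  · refine headSum_le_of_map ha ht0 Prod.fst (fun i => le_of_eq ?_) hK
    have : ∀ x : α × β, (if x.1 = i then tensor a b x else 0)
        = if x = (i, j) then a i else 0 := by
      rintro ⟨y, z⟩
      by_cases hz : z = j
      · subst hz
        by_cases hy : y = i
        · simp [hy, tensor, hj]
        · simp [hy]
      · simp [hz, tensor, hj0 z hz]
    rw [Finset.sum_filter, Finset.sum_congr rfl (fun x _ => this x)]
    simp
  · obtain ⟨T, hT, hTs⟩ := exists_headSum_eq a hK
    have h := sum_le_headSum ht0 (K := K) (T.map ⟨fun i => (i, j), fun x y h => by simpa using h⟩)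
      (by rwa [Finset.card_map])
    rw [Finset.sum_map] at h
    rw [hTs]
    refine le_trans (le_of_eq (Finset.sum_congr rfl fun i _ => ?_)) h
    change a i = a i * b j
    rw [hj, mul_one]

lemma headSum_zero {α : Type*} [Fintype α] (a : α → ℝ) : headSum a 0 = 0 := by
  obtain ⟨T, hT, hTs⟩ := exists_headSum_eq a le_rfl
  have hT0 : T = ∅ := by
    rw [← Finset.card_eq_zero]
    exact_mod_cast le_antisymm hT (Nat.cast_nonneg _)
  rw [hTs, hT0, Finset.sum_empty]

lemma tpow_nonneg {α : Type*} {a : α → ℝ} (ha : ∀ i, 0 ≤ a i) (n : ℕ) (f : Fin n → α) :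
    0 ≤ tpow a n f :=
  Finset.prod_nonneg (fun _ _ => ha _)

lemma IsProbDist.tpow {α : Type*} [Fintype α] {a : α → ℝ} (ha : IsProbDist a) (n : ℕ) :
    IsProbDist (tpow a n) := by
  classical
  refine ⟨tpow_nonneg ha.1 n, ?_⟩
  have h := Fintype.sum_pow a n
  rw [ha.2, one_pow] at h
  exact h.symm

lemma IsProbDist.tensor {α β : Type*} [Fintype α] [Fintype β] {a : α → ℝ} {b : β → ℝ}
    (ha : IsProbDist a) (hb : IsProbDist b) : IsProbDist (tensor a b) := by
  refine ⟨fun x => mul_nonneg (ha.1 _) (hb.1 _), ?_⟩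
  have h := Finset.sum_mul_sum Finset.univ Finset.univ a b
  rw [ha.2, hb.2, one_mul] at h
  rw [Fintype.sum_prod_type]
  exact h.symm

lemma IsSharp.tpow {α : Type*} [Fintype α] {a : α → ℝ} (ha : IsSharp a) (n : ℕ) :
    IsSharp (tpow a n) := by
  obtain ⟨i, hi, hi0⟩ := ha
  refine ⟨fun _ => i, by simp [_root_.tpow, hi], fun f hf => ?_⟩
  obtain ⟨j, hj⟩ := Function.ne_iff.1 hf
  exact Finset.prod_eq_zero (Finset.mem_univ j) (hi0 _ hj)

lemma headSum_tpow_succ_le {α : Type*} [Fintype α] {a : α → ℝ} (ha : IsProbDist a) (n : ℕ)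
    {K : ℝ} (hK : 0 ≤ K) : headSum (tpow a (n + 1)) K ≤ headSum (tpow a n) K := by
  classical
  refine headSum_le_of_map (tpow_nonneg ha.1 n) (tpow_nonneg ha.1 _) Fin.tail
    (fun f => le_of_eq ?_) hK
  rw [Finset.sum_filter, ← Equiv.sum_comp (Fin.consEquiv (fun _ : Fin (n + 1) => α)),
    Fintype.sum_prod_type]
  have h : ∀ x : α, ∑ y : Fin n → α, (if Fin.tail (Fin.consEquiv (fun _ : Fin (n + 1) => α) (x, y)) = f
      then tpow a (n + 1) (Fin.consEquiv (fun _ : Fin (n + 1) => α) (x, y)) else 0)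
      = a x * tpow a n f := by
    intro x
    rw [Finset.sum_eq_single f]
    · simp [Fin.consEquiv, tpow, Fin.prod_univ_succ]
    · intro y _ hy
      simp [Fin.consEquiv, hy]
    · simp
  rw [Finset.sum_congr rfl (fun x _ => h x), ← Finset.sum_mul, ha.2, one_mul]

lemma headSum_tpow_antitone {α : Type*} [Fintype α] {a : α → ℝ} (ha : IsProbDist a)
    {K : ℝ} (hK : 0 ≤ K) : Antitone (fun n => headSum (tpow a n) K) :=
  antitone_nat_of_succ_le (fun n => headSum_tpow_succ_le ha n hK)

lemma sum_le_sum_add_tvd {α : Type*} [Fintype α] {a b : α → ℝ} (ha : IsProbDist a)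
    (hb : IsProbDist b) (T : Finset α) : ∑ i ∈ T, b i ≤ ∑ i ∈ T, a i + tvd a b := by
  classical
  have h1 : ∑ i, (b i - a i) = 0 := by rw [Finset.sum_sub_distrib, ha.2, hb.2, sub_self]
  have h2 : ∑ i ∈ T, (b i - a i) ≤ ∑ i ∈ T, (|a i - b i| + (b i - a i)) / 2 :=
    Finset.sum_le_sum fun i _ => by
      have := neg_le_abs (a i - b i)
      linarith
  have h3 : ∑ i ∈ T, (|a i - b i| + (b i - a i)) / 2
      ≤ ∑ i, (|a i - b i| + (b i - a i)) / 2 := by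
    refine Finset.sum_le_sum_of_subset_of_nonneg (Finset.subset_univ _) fun i _ _ => ?_
    have := le_abs_self (a i - b i)
    linarith
  have h4 := h2.trans h3
  rw [← Finset.sum_div, Finset.sum_add_distrib, h1, Finset.sum_sub_distrib] at h4
  unfold tvd
  linarith

/-- Head-sum criterion for approximate majorisation from below. -/
lemma approxSubMajTV_iff {α β : Type*} [Fintype α] [Fintype β] {a : α → ℝ} {b : β → ℝ}
    (ha : IsProbDist a) (hb : IsProbDist b) {ε : ℝ} (hε : 0 ≤ ε) :
    ApproxSubMajTV a b ε ↔ ∀ k : ℕ, headSum a (k : ℝ) ≤ headSum b (k : ℝ) + ε := by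
  constructor
  · rintro ⟨bt, hbt, hmaj, htv⟩ k
    refine (hmaj k).trans ?_
    obtain ⟨T, hT, hTs⟩ := exists_headSum_eq bt (Nat.cast_nonneg (α := ℝ) k)
    rw [hTs]
    have := sum_le_sum_add_tvd hb hbt T
    have := sum_le_headSum hb.1 T hT
    linarith
  · intro h
    set N := Fintype.card β with hN
    have hNpos : 0 < N := by
      rcases Nat.eq_zero_or_pos N with h0 | h0
      · exfalso
        have := Fintype.card_eq_zero_iff.1 h0
        have := hb.2
        simp at this
      · exact h0
    have hrange : ∀ (f : ℕ → ℝ) (k : ℕ),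
        ∑ i ∈ Finset.univ.filter (fun i : Fin N => ((i : ℕ) + 1 : ℝ) ≤ (k : ℝ)), f i
          = ∑ i ∈ Finset.range (min N k), f i := by
      intro f k
      rw [Finset.sum_filter]
      have e : ∀ i : Fin N, (if ((i : ℕ) + 1 : ℝ) ≤ (k : ℝ) then f i else 0)
          = (fun j : ℕ => if j < k then f j else 0) i := by
        intro i
        have : (((i : ℕ) + 1 : ℝ) ≤ (k : ℝ)) ↔ (i : ℕ) < k := by
          rw [← Nat.succ_le_iff]
          exact_mod_cast Iff.rfl
        simp [this]
      rw [Finset.sum_congr rfl (fun i _ => e i),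
        Fin.sum_univ_eq_sum_range (fun j : ℕ => if j < k then f j else 0) N, ← Finset.sum_filter]
      refine Finset.sum_congr ?_ fun _ _ => rfl
      ext i
      simp
    set d : ℕ → ℝ := fun j => if hj : j < N then descSorted b ⟨j, hj⟩ else 0 with hd
    have hdF : ∀ i : Fin N, descSorted b i = d i := fun i => by simp [hd, i.2]
    have hhead : ∀ k : ℕ, headSum b (k : ℝ) = ∑ i ∈ Finset.range (min N k), d i := by
      intro k
      rw [← hrange]
      exact Finset.sum_congr rfl fun i _ => hdF i
    have hstep : ∀ i : Fin N, headSum b (((i : ℕ) + 1 : ℕ) : ℝ)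
        = headSum b ((i : ℕ) : ℝ) + descSorted b i := by
      intro i
      rw [hhead, hhead, min_eq_right (Nat.succ_le_of_lt i.2), min_eq_right i.2.le,
        Finset.sum_range_succ, hdF]
    have hfull : headSum b (N : ℝ) = 1 := by
      rw [hhead, min_self, ← Fin.sum_univ_eq_sum_range, ← hb.2,
        ← Equiv.sum_comp (descEquiv b) b]
      exact Finset.sum_congr rfl fun i _ => (hdF i).symm
    have hzero : headSum b ((0 : ℕ) : ℝ) = 0 := by rw [Nat.cast_zero, headSum_zero]
    set c : ℕ → ℝ := fun j => if j = 0 then 0 else min 1 (headSum b (j : ℝ) + ε) with hc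
    have hcN : ∀ k, N ≤ k → c k = 1 := by
      intro k hk
      have h1 : 1 ≤ headSum b (k : ℝ) := by
        rw [← hfull]; exact headSum_mono hb.1 (by exact_mod_cast hk)
      have h0 : k ≠ 0 := by omega
      simp only [hc, h0, if_false]
      exact min_eq_left (by linarith)
    have hd0 : ∀ i, 0 ≤ descSorted b i := fun i => hb.1 _
    have hcmono : ∀ i : Fin N, 0 ≤ c ((i : ℕ) + 1) - c i := by
      intro i
      rw [sub_nonneg]
      simp only [hc, Nat.succ_ne_zero, if_false]
      split_ifs with h0
      · exact le_min zero_le_one (add_nonneg (headSum_nonneg hb.1 _) hε)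
      · refine min_le_min le_rfl ?_
        rw [hstep]
        linarith [hd0 i]
    have hclip : ∀ i : Fin N, |descSorted b i - (c ((i : ℕ) + 1) - c i)|
        ≤ (descSorted b i - (c ((i : ℕ) + 1) - c i)) + if (i : ℕ) = 0 then 2 * ε else 0 := by
      intro i
      have hs := hstep i
      have hle := headSum_le_one hb (((i : ℕ) + 1 : ℕ) : ℝ)
      simp only [hc, Nat.succ_ne_zero, if_false]
      by_cases h0 : (i : ℕ) = 0
      · simp only [h0, if_true] at hs hle ⊢
        rw [hzero] at hs
        rw [abs_le]
        have h1 := min_le_right 1 (headSum b ((0 + 1 : ℕ) : ℝ) + ε)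
        have h2 : headSum b ((0 + 1 : ℕ) : ℝ) ≤ min 1 (headSum b ((0 + 1 : ℕ) : ℝ) + ε) :=
          le_min hle (by linarith)
        constructor <;> linarith
      · simp only [h0, if_false, add_zero]
        refine le_of_eq (abs_of_nonneg ?_)
        rw [sub_nonneg, hs, sub_le_iff_le_add]
        have hd := hd0 i
        rcases le_total 1 (headSum b ((i : ℕ) : ℝ) + ε) with h1 | h1
        · rw [min_eq_left h1]
          exact (min_le_left _ _).trans (by linarith)
        · rw [min_eq_right h1]
          exact (min_le_right _ _).trans (by linarith)
    have htele : ∀ k : ℕ, ∑ i ∈ Finset.range k, (c (i + 1) - c i) = c k := by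
      intro k
      rw [Finset.sum_range_sub]
      simp [hc]
    set bt : β → ℝ := fun x =>
      c (((descEquiv b).symm x : ℕ) + 1) - c ((descEquiv b).symm x : ℕ) with hbt
    have hsum : ∀ f : β → ℝ, ∑ x, f x = ∑ i : Fin N, f (descEquiv b i) := fun f =>
      (Equiv.sum_comp (descEquiv b) f).symm
    have hbtp : IsProbDist bt := by
      refine ⟨fun x => hcmono _, ?_⟩
      rw [hsum]
      simp only [hbt, Equiv.symm_apply_apply]
      rw [Fin.sum_univ_eq_sum_range (fun j => c (j + 1) - c j) N, htele, hcN N le_rfl]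
    refine ⟨bt, hbtp, fun k => ?_, ?_⟩
    · have hk := sum_le_headSum hbtp.1 (K := (k : ℝ)) ((Finset.univ.filter
        (fun i : Fin N => ((i : ℕ) + 1 : ℝ) ≤ (k : ℝ))).map (descEquiv b).toEmbedding)
        (by rw [Finset.card_map]; exact card_filter_succ_le _ (Nat.cast_nonneg k))
      rw [Finset.sum_map] at hk
      refine le_trans ?_ hk
      simp only [hbt, Equiv.coe_toEmbedding, Equiv.symm_apply_apply]
      rw [hrange (fun j => c (j + 1) - c j), htele]
      rcases le_total N k with hNk | hNk
      · rw [min_eq_left hNk, hcN N le_rfl]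
        exact headSum_le_one ha _
      · rw [min_eq_right hNk]
        rcases Nat.eq_zero_or_pos k with h0 | h0
        · subst h0
          rw [Nat.cast_zero, headSum_zero]
          simp [hc]
        · simp only [hc, h0.ne', if_false]
          exact le_min (headSum_le_one ha _) (h k)
    · unfold tvd
      rw [hsum]
      simp only [hbt, Equiv.symm_apply_apply]
      have hs1 := Finset.sum_le_sum (fun i (_ : i ∈ Finset.univ) => hclip i)
      have hs2 : ∑ i : Fin N, descSorted b i = 1 := by
        rw [← hb.2, hsum b]; rfl
      have hs3 : ∑ i : Fin N, (if (i : ℕ) = 0 then 2 * ε else 0) = 2 * ε := by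
        rw [Finset.sum_eq_single (⟨0, hNpos⟩ : Fin N)]
        · simp
        · intro i _ hi
          rw [if_neg]
          intro h0
          exact hi (Fin.ext h0)
        · simp
      rw [Finset.sum_add_distrib, Finset.sum_sub_distrib, hs2, hs3,
        Fin.sum_univ_eq_sum_range (fun j => c (j + 1) - c j) N, htele, hcN N le_rfl] at hs1
      simp only [descSorted_eq] at hs1
      linarith

lemma sum_filter_ge_mul_exp_le {α : Type*} [Fintype α] {w : α → ℝ} (hw : ∀ i, 0 ≤ w i)
    (Z : α → ℝ) (c y : ℝ) {h : ℝ} (hh : 0 ≤ h) :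
    ∑ i ∈ Finset.univ.filter (fun i => y ≤ Z i), w i * Real.exp (c * Z i)
      ≤ Real.exp (-(h * y)) * ∑ i, w i * Real.exp ((c + h) * Z i) := by
  rw [Finset.mul_sum]
  refine le_trans (Finset.sum_le_sum fun i hi => ?_)
    (Finset.sum_le_sum_of_subset_of_nonneg (Finset.subset_univ _) fun i _ _ =>
      mul_nonneg (Real.exp_pos _).le (mul_nonneg (hw i) (Real.exp_pos _).le))
  have hi' : y ≤ Z i := by simpa using hi
  rw [mul_left_comm, ← Real.exp_add]
  refine mul_le_mul_of_nonneg_left (Real.exp_le_exp.2 ?_) (hw i)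
  nlinarith [mul_le_mul_of_nonneg_left hi' hh]

lemma sum_filter_le_mul_exp_le {α : Type*} [Fintype α] {w : α → ℝ} (hw : ∀ i, 0 ≤ w i)
    (Z : α → ℝ) (c y : ℝ) {h : ℝ} (hh : 0 ≤ h) :
    ∑ i ∈ Finset.univ.filter (fun i => Z i ≤ y), w i * Real.exp (c * Z i)
      ≤ Real.exp (h * y) * ∑ i, w i * Real.exp ((c - h) * Z i) := by
  rw [Finset.mul_sum]
  refine le_trans (Finset.sum_le_sum fun i hi => ?_)
    (Finset.sum_le_sum_of_subset_of_nonneg (Finset.subset_univ _) fun i _ _ =>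
      mul_nonneg (Real.exp_pos _).le (mul_nonneg (hw i) (Real.exp_pos _).le))
  have hi' : Z i ≤ y := by simpa using hi
  rw [mul_left_comm, ← Real.exp_add]
  refine mul_le_mul_of_nonneg_left (Real.exp_le_exp.2 ?_) (hw i)
  nlinarith [mul_le_mul_of_nonneg_left hi' hh]

lemma sum_mul_exp_le_window {α : Type*} [Fintype α] {w : α → ℝ} (hw : ∀ i, 0 ≤ w i)
    (Z : α → ℝ) {c : ℝ} (hc : 0 ≤ c) (x y : ℝ) :
    ∑ i, w i * Real.exp (c * Z i)
      ≤ ∑ i ∈ Finset.univ.filter (fun i => Z i ≤ x), w i * Real.exp (c * Z i)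
        + ∑ i ∈ Finset.univ.filter (fun i => y ≤ Z i), w i * Real.exp (c * Z i)
        + Real.exp (c * y) * ∑ i ∈ Finset.univ.filter (fun i => x ≤ Z i), w i := by
  rw [Finset.mul_sum, Finset.sum_filter, Finset.sum_filter, Finset.sum_filter,
    ← Finset.sum_add_distrib, ← Finset.sum_add_distrib]
  refine Finset.sum_le_sum fun i _ => ?_
  have h1 : 0 ≤ w i * Real.exp (c * Z i) := mul_nonneg (hw i) (Real.exp_pos _).le
  have h2 : 0 ≤ Real.exp (c * y) * w i := mul_nonneg (Real.exp_pos _).le (hw i)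
  rcases le_or_gt (Z i) x with h | h
  · rw [if_pos h]
    split_ifs <;> linarith
  · rw [if_neg (not_le.2 h), if_pos h.le]
    rcases le_or_gt y (Z i) with h' | h'
    · rw [if_pos h']
      linarith
    · rw [if_neg (not_le.2 h'), mul_comm (Real.exp (c * y))]
      have := mul_le_mul_of_nonneg_left
        (Real.exp_le_exp.2 (mul_le_mul_of_nonneg_left h'.le hc)) (hw i)
      linarith

/-- The scaled logarithmic moment generating functions of `Z n` under `w n`, at speed `a n`,
converge to those of a centred Gaussian of variance `σ`. -/
structure GaussianMGFLimit {α : ℕ → Type*} [∀ n, Fintype (α n)] (w Z : ∀ n, α n → ℝ)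
    (a : ℕ → ℝ) (σ : ℝ) : Prop where
  nonneg : ∀ n i, 0 ≤ w n i
  pos : ∀ n c, 0 < ∑ i, w n i * Real.exp (c * Z n i)
  speed : Tendsto a atTop atTop
  var_pos : 0 < σ
  lim : ∀ c, Tendsto (fun n => Real.log (∑ i, w n i * Real.exp (c * Z n i)) / a n) atTop
    (𝓝 (c ^ 2 * σ / 2))

namespace GaussianMGFLimit

variable {α : ℕ → Type*} [∀ n, Fintype (α n)] {w Z : ∀ n, α n → ℝ} {a : ℕ → ℝ} {σ : ℝ}

lemma neg (h : GaussianMGFLimit w Z a σ) : GaussianMGFLimit w (fun n i => -Z n i) a σ where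
  nonneg := h.nonneg
  pos n c := by simpa using h.pos n (-c)
  speed := h.speed
  var_pos := h.var_pos
  lim c := by simpa using h.lim (-c)

lemma eventually_le (h : GaussianMGFLimit w Z a σ) (c : ℝ) {b : ℝ} (hb : c ^ 2 * σ / 2 < b) :
    ∀ᶠ n in atTop, ∑ i, w n i * Real.exp (c * Z n i) ≤ Real.exp (b * a n) := by
  filter_upwards [(h.lim c).eventually_lt_const hb, h.speed.eventually_gt_atTop 0] with n h1 h2
  rw [← Real.log_le_iff_le_exp (h.pos n c)]
  exact ((div_lt_iff₀ h2).1 h1).le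

lemma eventually_ge (h : GaussianMGFLimit w Z a σ) (c : ℝ) {b : ℝ} (hb : b < c ^ 2 * σ / 2) :
    ∀ᶠ n in atTop, Real.exp (b * a n) ≤ ∑ i, w n i * Real.exp (c * Z n i) := by
  filter_upwards [(h.lim c).eventually_const_lt hb, h.speed.eventually_gt_atTop 0] with n h1 h2
  rw [← Real.le_log_iff_exp_le (h.pos n c)]
  exact ((lt_div_iff₀ h2).1 h1).le

lemma tail_le (h : GaussianMGFLimit w Z a σ) {x η : ℝ} (hx : 0 ≤ x) (hη : η < x ^ 2 / (2 * σ)) :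
    ∀ᶠ n in atTop, ∑ i ∈ Finset.univ.filter (fun i => x * a n ≤ Z n i), w n i
      ≤ Real.exp (-(η * a n)) := by
  have hσ := h.var_pos
  have e : (x / σ) ^ 2 * σ / 2 = x / σ * x - x ^ 2 / (2 * σ) := by field_simp; ring
  filter_upwards [h.eventually_le (x / σ) (b := x / σ * x - η) (by linarith)] with n hn
  have h1 := sum_filter_ge_mul_exp_le (h.nonneg n) (Z n) 0 (x * a n) (div_nonneg hx hσ.le)
  simp only [zero_mul, Real.exp_zero, mul_one, zero_add] at h1
  refine h1.trans ((mul_le_mul_of_nonneg_left hn (Real.exp_pos _).le).trans (le_of_eq ?_))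
  rw [← Real.exp_add]
  ring_nf

lemma le_tail (h : GaussianMGFLimit w Z a σ) {x η : ℝ} (hx : 0 ≤ x) (hη : x ^ 2 / (2 * σ) < η) :
    ∀ᶠ n in atTop, Real.exp (-(η * a n))
      ≤ ∑ i ∈ Finset.univ.filter (fun i => x * a n ≤ Z n i), w n i := by
  have hσ := h.var_pos
  obtain ⟨δ, hδ, hδη⟩ : ∃ δ > 0,
      (x + δ) * (x + 2 * δ) / σ - (x + δ) ^ 2 / (2 * σ) + δ ^ 2 / (8 * σ) < η := by
    have hcont : ContinuousAt (fun δ : ℝ =>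
        (x + δ) * (x + 2 * δ) / σ - (x + δ) ^ 2 / (2 * σ) + δ ^ 2 / (8 * σ)) 0 := by fun_prop
    have h0 : (x + 0) * (x + 2 * 0) / σ - (x + 0) ^ 2 / (2 * σ) + 0 ^ 2 / (8 * σ) < η := by
      refine lt_of_eq_of_lt ?_ hη
      field_simp
      ring
    have hev : ∀ᶠ δ in 𝓝[>] (0 : ℝ), _ :=
      (hcont.eventually_lt_const h0).filter_mono nhdsWithin_le_nhds
    obtain ⟨δ, h1, h2⟩ := (hev.and self_mem_nhdsWithin).exists
    exact ⟨δ, h2, h1⟩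
  set c := (x + δ) / σ with hc
  set k := δ / σ with hk
  set γ := δ ^ 2 / (8 * σ) with hγ
  have hγ0 : 0 < γ := by positivity
  have hk0 : 0 ≤ k := by positivity
  have hc0 : 0 ≤ c := by positivity
  have e0 : c ^ 2 * σ / 2 = (x + δ) ^ 2 / (2 * σ) := by rw [hc]; field_simp
  have e1 : k * x + (c - k) ^ 2 * σ / 2 = (x + δ) ^ 2 / (2 * σ) - 4 * γ := by
    rw [hc, hk, hγ]; field_simp; ring
  have e2 : -(k * (x + 2 * δ)) + (c + k) ^ 2 * σ / 2 = (x + δ) ^ 2 / (2 * σ) - 4 * γ := by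
    rw [hc, hk, hγ]; field_simp; ring
  have e3 : c * (x + 2 * δ) = (x + δ) * (x + 2 * δ) / σ := by rw [hc]; field_simp
  set B := (x + δ) ^ 2 / (2 * σ) with hB
  have hγη : 0 < η - (c * (x + 2 * δ) - B + γ) := by rw [e3]; linarith
  filter_upwards [h.eventually_ge c (b := B - γ) (by rw [e0]; linarith),
    h.eventually_le (c - k) (b := (c - k) ^ 2 * σ / 2 + γ) (by linarith),
    h.eventually_le (c + k) (b := (c + k) ^ 2 * σ / 2 + γ) (by linarith),
    h.speed.eventually_ge_atTop (Real.log 4 / γ),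
    h.speed.eventually_ge_atTop (Real.log 2 / (η - (c * (x + 2 * δ) - B + γ)))] with n h1 h2 h3 h4 h5
  have b1 := sum_filter_le_mul_exp_le (h.nonneg n) (Z n) c (x * a n) hk0
  have b2 := sum_filter_ge_mul_exp_le (h.nonneg n) (Z n) c ((x + 2 * δ) * a n) hk0
  have b3 := sum_mul_exp_le_window (h.nonneg n) (Z n) hc0 (x * a n) ((x + 2 * δ) * a n)
  replace b1 := b1.trans (mul_le_mul_of_nonneg_left h2 (Real.exp_pos _).le)
  replace b2 := b2.trans (mul_le_mul_of_nonneg_left h3 (Real.exp_pos _).le)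
  rw [← Real.exp_add] at b1 b2
  rw [show k * (x * a n) + ((c - k) ^ 2 * σ / 2 + γ) * a n
    = (B - 3 * γ) * a n by linear_combination (a n) * e1] at b1
  rw [show -(k * ((x + 2 * δ) * a n)) + ((c + k) ^ 2 * σ / 2 + γ) * a n
    = (B - 3 * γ) * a n by linear_combination (a n) * e2] at b2
  have h4' : 4 ≤ Real.exp (γ * a n) := by
    rw [← Real.log_le_iff_le_exp (by norm_num)]
    rwa [div_le_iff₀ hγ0, mul_comm] at h4
  have h5' : 2 ≤ Real.exp ((η - (c * (x + 2 * δ) - B + γ)) * a n) := by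
    rw [← Real.log_le_iff_le_exp (by norm_num)]
    rwa [div_le_iff₀ hγη, mul_comm] at h5
  have h6 : 4 * Real.exp ((B - 3 * γ) * a n) ≤ Real.exp ((B - γ) * a n) := by
    have hpos : 0 ≤ a n := le_trans (div_nonneg (Real.log_nonneg (by norm_num)) hγ0.le) h4
    calc 4 * Real.exp ((B - 3 * γ) * a n)
        ≤ Real.exp (γ * a n) * Real.exp ((B - 3 * γ) * a n) :=
          mul_le_mul_of_nonneg_right h4' (Real.exp_pos _).le
      _ ≤ Real.exp ((B - γ) * a n) := by
          rw [← Real.exp_add, Real.exp_le_exp]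
          nlinarith [mul_nonneg hγ0.le hpos]
  set P := ∑ i ∈ Finset.univ.filter (fun i => x * a n ≤ Z n i), w n i with hP
  have h7 : Real.exp ((B - γ) * a n) ≤ 2 * (Real.exp (c * ((x + 2 * δ) * a n)) * P) := by
    linarith
  have h8 : Real.exp (-(η * a n)) * 2 * Real.exp (c * ((x + 2 * δ) * a n))
      ≤ Real.exp ((B - γ) * a n) := by
    calc Real.exp (-(η * a n)) * 2 * Real.exp (c * ((x + 2 * δ) * a n))
        ≤ Real.exp (-(η * a n)) * Real.exp ((η - (c * (x + 2 * δ) - B + γ)) * a n)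
          * Real.exp (c * ((x + 2 * δ) * a n)) := by gcongr
      _ = Real.exp ((B - γ) * a n) := by
          rw [← Real.exp_add, ← Real.exp_add]
          ring_nf
  have h9 : Real.exp (-(η * a n)) * (2 * Real.exp (c * ((x + 2 * δ) * a n)))
      ≤ P * (2 * Real.exp (c * ((x + 2 * δ) * a n))) := by linarith
  exact le_of_mul_le_mul_right h9 (by positivity)

end GaussianMGFLimit

lemma sum_le_headSum_exp {α : Type*} [Fintype α] {a : α → ℝ} (ha : IsProbDist a) (y : ℝ) :
    ∑ i ∈ Finset.univ.filter (fun i => -Real.log (a i) ≤ y), a i ≤ headSum a (Real.exp y) := by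
  classical
  set T := Finset.univ.filter (fun i => -Real.log (a i) ≤ y) with hT
  have h1 : ∑ i ∈ T, a i = ∑ i ∈ T.filter (fun i => a i ≠ 0), a i :=
    (Finset.sum_filter_ne_zero T).symm
  rw [h1]
  refine sum_le_headSum ha.1 _ ?_
  set T' := T.filter (fun i => a i ≠ 0) with hT'
  have h2 : T'.card • Real.exp (-y) ≤ ∑ i ∈ T', a i := by
    refine Finset.card_nsmul_le_sum _ _ _ fun i hi => ?_
    rw [hT', Finset.mem_filter, hT, Finset.mem_filter] at hi
    have hpos : 0 < a i := lt_of_le_of_ne (ha.1 i) (Ne.symm hi.2)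
    rw [← Real.le_log_iff_exp_le hpos]
    linarith [hi.1.2]
  have h3 : ∑ i ∈ T', a i ≤ 1 := by
    rw [← ha.2]
    exact Finset.sum_le_sum_of_subset_of_nonneg (Finset.subset_univ _) fun i _ _ => ha.1 i
  have h4 : (T'.card : ℝ) * Real.exp (-y) ≤ 1 := by
    rw [← nsmul_eq_mul]; exact h2.trans h3
  rw [Real.exp_neg, ← div_eq_mul_inv, div_le_one (Real.exp_pos _)] at h4
  exact h4

lemma headSum_exp_le {α : Type*} [Fintype α] {a : α → ℝ} (ha : IsProbDist a) (y g : ℝ) :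
    headSum a (Real.exp y)
      ≤ ∑ i ∈ Finset.univ.filter (fun i => -Real.log (a i) < y + g), a i + Real.exp (-g) := by
  classical
  obtain ⟨T, hT, hTs⟩ := exists_headSum_eq a (Real.exp_pos y).le
  rw [hTs, ← Finset.sum_filter_add_sum_filter_not T (fun i => -Real.log (a i) < y + g)]
  refine add_le_add ?_ ?_
  · exact Finset.sum_le_sum_of_subset_of_nonneg
      (Finset.filter_subset_filter _ (Finset.subset_univ _)) fun i _ _ => ha.1 i
  · have h1 : ∑ i ∈ T.filter (fun i => ¬ -Real.log (a i) < y + g), a i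
        ≤ (T.filter (fun i => ¬ -Real.log (a i) < y + g)).card • Real.exp (-(y + g)) := by
      refine Finset.sum_le_card_nsmul _ _ _ fun i hi => ?_
      have hi2 := (Finset.mem_filter.1 hi).2
      rcases (ha.1 i).eq_or_lt with h0 | h0
      · rw [← h0]; exact (Real.exp_pos _).le
      · rw [← Real.log_le_iff_le_exp h0]
        linarith
    refine h1.trans ?_
    rw [nsmul_eq_mul]
    have h2 : ((T.filter (fun i => ¬ -Real.log (a i) < y + g)).card : ℝ) ≤ Real.exp y :=
      le_trans (by exact_mod_cast Finset.card_filter_le _ _) hT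
    refine (mul_le_mul_of_nonneg_right h2 (Real.exp_pos _).le).trans (le_of_eq ?_)
    rw [← Real.exp_add]
    ring_nf

lemma one_sub_headSum_exp_le {α : Type*} [Fintype α] {a : α → ℝ} (ha : IsProbDist a) (y : ℝ) :
    1 - headSum a (Real.exp y)
      ≤ ∑ i ∈ Finset.univ.filter (fun i => y ≤ -Real.log (a i)), a i := by
  have h1 := sum_le_headSum_exp ha y
  have h2 := Finset.sum_filter_add_sum_filter_not Finset.univ (fun i => -Real.log (a i) ≤ y) a
  rw [ha.2] at h2
  have h3 : ∑ i ∈ Finset.univ.filter (fun i => ¬ -Real.log (a i) ≤ y), a i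
      ≤ ∑ i ∈ Finset.univ.filter (fun i => y ≤ -Real.log (a i)), a i := by
    refine Finset.sum_le_sum_of_subset_of_nonneg (fun i hi => ?_) fun i _ _ => ha.1 i
    simp only [Finset.mem_filter, Finset.mem_univ, true_and, not_le] at hi ⊢
    exact hi.le
  linarith

lemma le_one_sub_headSum_exp {α : Type*} [Fintype α] {a : α → ℝ} (ha : IsProbDist a) (y g : ℝ) :
    ∑ i ∈ Finset.univ.filter (fun i => y + g ≤ -Real.log (a i)), a i - Real.exp (-g)
      ≤ 1 - headSum a (Real.exp y) := by
  have h1 := headSum_exp_le ha y g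
  have h2 := Finset.sum_filter_add_sum_filter_not Finset.univ
    (fun i => -Real.log (a i) < y + g) a
  rw [ha.2] at h2
  simp only [not_lt] at h2
  linarith

/-- The exponential generating function of the surprisal `-log a` under `a`. -/
def surprisalMGF {α : Type*} [Fintype α] (a : α → ℝ) (θ : ℝ) : ℝ :=
  ∑ i, a i * Real.exp (-(θ * Real.log (a i)))

lemma surprisalMGF_pos {α : Type*} [Fintype α] {a : α → ℝ} (ha : IsProbDist a) (θ : ℝ) :
    0 < surprisalMGF a θ := by
  have h0 : ∀ i ∈ Finset.univ, 0 ≤ a i * Real.exp (-(θ * Real.log (a i))) := fun i _ =>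
    mul_nonneg (ha.1 i) (Real.exp_pos _).le
  refine lt_of_le_of_ne (Finset.sum_nonneg h0) fun h => ?_
  have h1 := (Finset.sum_eq_zero_iff_of_nonneg h0).1 h.symm
  have h2 : ∑ i, a i = 0 := Finset.sum_eq_zero fun i hi =>
    (mul_eq_zero.1 (h1 i hi)).resolve_right (Real.exp_pos _).ne'
  rw [ha.2] at h2
  exact one_ne_zero h2

lemma surprisalMGF_tpow {α : Type*} [Fintype α] (a : α → ℝ) (n : ℕ) (θ : ℝ) :
    surprisalMGF (tpow a n) θ = surprisalMGF a θ ^ n := by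
  classical
  unfold surprisalMGF
  rw [Fintype.sum_pow]
  refine Finset.sum_congr rfl fun f _ => ?_
  rw [Finset.prod_mul_distrib]
  by_cases h : ∏ j, a (f j) = 0
  · simp [tpow, h]
  · have h' : ∀ j ∈ Finset.univ, a (f j) ≠ 0 := fun j hj => Finset.prod_ne_zero_iff.1 h j hj
    rw [← Real.exp_sum]
    unfold tpow
    rw [Real.log_prod h', Finset.mul_sum, Finset.sum_neg_distrib]

lemma log_surprisalMGF_isLittleO {α : Type*} [Fintype α] {a : α → ℝ} (ha : IsProbDist a) :
    (fun θ => Real.log (surprisalMGF a θ) - θ * shannonH a - θ ^ 2 * entV a / 2)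
      =o[𝓝 0] fun θ : ℝ => θ ^ 2 := by
  set Y : α → ℝ := fun i => Real.log (a i) + shannonH a with hY
  set g : ℝ → ℝ := fun θ => ∑ i, a i * Real.exp (-θ * Y i) with hg
  have hgG : ∀ θ, g θ = Real.exp (-(θ * shannonH a)) * surprisalMGF a θ := by
    intro θ
    simp only [hg, surprisalMGF, Finset.mul_sum]
    refine Finset.sum_congr rfl fun i _ => ?_
    rw [mul_left_comm, ← Real.exp_add]
    simp only [hY]
    ring_nf
  have hlog : ∀ θ, Real.log (g θ) = Real.log (surprisalMGF a θ) - θ * shannonH a := by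
    intro θ
    rw [hgG, Real.log_mul (Real.exp_pos _).ne' (surprisalMGF_pos ha θ).ne', Real.log_exp]
    ring
  have hmean : ∑ i, a i * Y i = 0 := by
    simp only [hY, mul_add, Finset.sum_add_distrib, ← Finset.sum_mul, ha.2]
    simp [shannonH]
  have hexp : ∀ y : ℝ, (fun θ : ℝ => Real.exp (-θ * y) - 1 + θ * y - (θ * y) ^ 2 / 2)
      =o[𝓝 0] fun θ : ℝ => θ ^ 2 := by
    intro y
    have h1 := Real.exp_sub_sum_range_isBigO_pow 3
    have ht : Tendsto (fun θ : ℝ => -θ * y) (𝓝 0) (𝓝 0) := by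
      have : ContinuousAt (fun θ : ℝ => -θ * y) 0 := by fun_prop
      simpa [ContinuousAt] using this
    have h2 := h1.comp_tendsto ht
    have h3 : (fun θ : ℝ => (-θ * y) ^ 3) =o[𝓝 0] fun θ : ℝ => θ ^ 2 := by
      have : (fun θ : ℝ => (-θ * y) ^ 3) = fun θ : ℝ => (-y ^ 3) * θ ^ 3 := by
        funext θ; ring
      rw [this]
      exact (Asymptotics.isLittleO_pow_pow (by norm_num)).const_mul_left _
    refine (h2.trans_isLittleO h3).congr_left fun θ => ?_
    simp [Finset.sum_range_succ, Nat.factorial]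
    ring
  have hquad : (fun θ => g θ - 1 - θ ^ 2 * entV a / 2) =o[𝓝 0] fun θ : ℝ => θ ^ 2 := by
    have h1 : (fun θ : ℝ => ∑ i, a i * (Real.exp (-θ * Y i) - 1 + θ * Y i - (θ * Y i) ^ 2 / 2))
        =o[𝓝 0] fun θ : ℝ => θ ^ 2 :=
      Asymptotics.IsLittleO.fun_sum fun i _ => (hexp (Y i)).const_mul_left _
    refine h1.congr_left fun θ => ?_
    have e : ∀ i, a i * (Real.exp (-θ * Y i) - 1 + θ * Y i - (θ * Y i) ^ 2 / 2)
        = a i * Real.exp (-θ * Y i) - a i + θ * (a i * Y i) - θ ^ 2 / 2 * (a i * Y i ^ 2) := by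
      intro i; ring
    rw [Finset.sum_congr rfl fun i _ => e i, Finset.sum_sub_distrib, Finset.sum_add_distrib,
      Finset.sum_sub_distrib, ← Finset.mul_sum, ← Finset.mul_sum, hmean, ha.2]
    simp only [hg, entV, hY]
    ring
  have hbig : (fun θ => g θ - 1) =O[𝓝 0] fun θ : ℝ => θ ^ 2 := by
    have h1 : (fun θ : ℝ => θ ^ 2 * entV a / 2) =O[𝓝 0] fun θ : ℝ => θ ^ 2 := by
      have : (fun θ : ℝ => θ ^ 2 * entV a / 2) = fun θ : ℝ => (entV a / 2) * θ ^ 2 := by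
        funext θ; ring
      rw [this]
      exact Asymptotics.isBigO_const_mul_self _ _ _
    exact (hquad.isBigO.add h1).congr_left fun θ => by ring
  have hg1 : Tendsto g (𝓝 0) (𝓝 1) := by
    have hc : ContinuousAt g 0 := by
      simp only [hg]
      fun_prop
    have : g 0 = 1 := by simp [hg, ha.2]
    rw [← this]
    exact hc
  have hlg : (fun θ => Real.log (g θ) - (g θ - 1)) =o[𝓝 0] fun θ : ℝ => θ ^ 2 := by
    have h1 := (Real.hasDerivAt_log one_ne_zero).isLittleO.comp_tendsto hg1
    refine (h1.trans_isBigO hbig).congr_left fun θ => ?_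
    simp
  exact (hlg.add hquad).congr_left fun θ => by rw [hlog]; ring

lemma ModerateSeq.eventually_pos {t : ℕ → ℝ} (ht : ModerateSeq t) : ∀ᶠ n in atTop, 0 < t n := by
  filter_upwards [ht.2.eventually_gt_atTop 0] with n hn
  exact pos_of_mul_pos_right hn (Real.sqrt_nonneg _)

lemma ModerateSeq.tendsto_mul_sq {t : ℕ → ℝ} (ht : ModerateSeq t) :
    Tendsto (fun n : ℕ => (n : ℝ) * t n ^ 2) atTop atTop := by
  refine (ht.2.atTop_mul_atTop₀ ht.2).congr fun n => ?_
  rw [mul_mul_mul_comm, Real.mul_self_sqrt (Nat.cast_nonneg n)]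
  ring

lemma ModerateSeq.tendsto_mul {t : ℕ → ℝ} (ht : ModerateSeq t) :
    Tendsto (fun n : ℕ => (n : ℝ) * t n) atTop atTop := by
  have h := (Real.tendsto_sqrt_atTop.comp tendsto_natCast_atTop_atTop).atTop_mul_atTop₀ ht.2
  refine h.congr fun n => ?_
  simp only [Function.comp]
  rw [← mul_assoc, Real.mul_self_sqrt (Nat.cast_nonneg n)]

/-- The surprisals of tensor powers satisfy a moderate deviation principle at the level of
generating functions. -/
lemma gaussianMGFLimit_tpow {α : Type*} [Fintype α] {a : α → ℝ} (ha : IsProbDist a)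
    (hV : 0 < entV a) {t : ℕ → ℝ} (ht : ModerateSeq t) {m : ℕ → ℕ} {κ : ℝ} (hκ : 0 < κ)
    (hm : Tendsto (fun n => (m n : ℝ) / n) atTop (𝓝 κ)) {C : ℕ → ℝ}
    (hC : Tendsto (fun n => (m n * shannonH a - C n) / (n * t n)) atTop (𝓝 0)) :
    GaussianMGFLimit (fun n => tpow a (m n))
      (fun n f => t n * (-Real.log (tpow a (m n) f) - C n))
      (fun n => (n : ℝ) * t n ^ 2) (κ * entV a) := by
  have key : ∀ n c, ∑ f, tpow a (m n) f
      * Real.exp (c * (t n * (-Real.log (tpow a (m n) f) - C n)))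
      = Real.exp (-(c * t n * C n)) * surprisalMGF a (c * t n) ^ m n := by
    intro n c
    rw [← surprisalMGF_tpow, surprisalMGF, Finset.mul_sum]
    refine Finset.sum_congr rfl fun f _ => ?_
    rw [mul_left_comm (Real.exp _), ← Real.exp_add]
    ring_nf
  refine ⟨fun n => tpow_nonneg ha.1 _, fun n c => ?_, ht.tendsto_mul_sq, mul_pos hκ hV,
    fun c => ?_⟩
  · rw [key]
    exact mul_pos (Real.exp_pos _) (pow_pos (surprisalMGF_pos ha _) _)
  · simp only [key]
    have hct : Tendsto (fun n => c * t n) atTop (𝓝 0) := by simpa using ht.1.const_mul c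
    have h1 := (log_surprisalMGF_isLittleO ha).comp_tendsto hct
    have h2 : (fun n => (c * t n) ^ 2) =O[atTop] fun n => t n ^ 2 := by
      simp only [mul_pow]
      exact Asymptotics.isBigO_const_mul_self _ _ _
    have h3 := (h1.trans_isBigO h2).tendsto_div_nhds_zero
    have h4 := ((hm.mul h3).add (hm.mul_const (c ^ 2 * entV a / 2))).add (hC.const_mul c)
    have e : κ * 0 + κ * (c ^ 2 * entV a / 2) + c * 0 = c ^ 2 * (κ * entV a) / 2 := by ring
    rw [e] at h4
    refine h4.congr' ?_
    filter_upwards [ht.eventually_pos, eventually_gt_atTop 0] with n htn hn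
    have hn' : (n : ℝ) ≠ 0 := by exact_mod_cast hn.ne'
    rw [Real.log_mul (Real.exp_pos _).ne' (pow_pos (surprisalMGF_pos ha _) _).ne', Real.log_exp,
      Real.log_pow]
    simp only [Function.comp]
    field_simp
    ring

lemma eventually_two_mul_exp_lt {a : ℕ → ℝ} (ha : Tendsto a atTop atTop) {η η' : ℝ}
    (h : η' < η) : ∀ᶠ n in atTop, 2 * Real.exp (-(η * a n)) < Real.exp (-(η' * a n)) := by
  have hpos : 0 < η - η' := sub_pos.2 h
  filter_upwards [ha.eventually_gt_atTop (Real.log 2 / (η - η'))] with n hn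
  rw [div_lt_iff₀ hpos] at hn
  calc 2 * Real.exp (-(η * a n)) = Real.exp (Real.log 2 + -(η * a n)) := by
        rw [Real.exp_add, Real.exp_log (by norm_num)]
    _ < Real.exp (-(η' * a n)) := by
        rw [Real.exp_lt_exp]
        linarith

lemma ModerateSeq.eventually_exp_le {t : ℕ → ℝ} (ht : ModerateSeq t) {δ : ℝ} (hδ : 0 < δ)
    (η : ℝ) : ∀ᶠ n : ℕ in atTop,
      Real.exp (-(δ * (n * t n))) ≤ Real.exp (-(η * ((n : ℝ) * t n ^ 2))) := by
  have h1 : Tendsto (fun n => η * t n) atTop (𝓝 0) := by simpa using ht.1.const_mul η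
  filter_upwards [h1.eventually_lt_const hδ, ht.eventually_pos] with n hn htn
  rw [Real.exp_le_exp]
  have h2 : 0 ≤ (n : ℝ) * t n := mul_nonneg (Nat.cast_nonneg n) htn.le
  nlinarith [mul_le_mul_of_nonneg_right hn.le h2]

/-- Distribution functions `F n` with Gaussian moderate deviations of variance `σ` at
speed `a n`. -/
structure ModerateCDF (F : ℕ → ℝ → ℝ) (a : ℕ → ℝ) (σ : ℝ) : Prop where
  var_pos : 0 < σ
  speed : Tendsto a atTop atTop
  mono : ∀ᶠ n in atTop, Monotone (F n)
  nonneg : ∀ n x, 0 ≤ F n x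
  le_one : ∀ n x, F n x ≤ 1
  lower_le : ∀ x η, x < 0 → η < x ^ 2 / (2 * σ) → ∀ᶠ n in atTop, F n x ≤ Real.exp (-(η * a n))
  le_lower : ∀ x η, x ≤ 0 → x ^ 2 / (2 * σ) < η → ∀ᶠ n in atTop, Real.exp (-(η * a n)) ≤ F n x
  upper_le : ∀ x η, 0 < x → η < x ^ 2 / (2 * σ) →
    ∀ᶠ n in atTop, 1 - F n x ≤ Real.exp (-(η * a n))
  le_upper : ∀ x η, 0 ≤ x → x ^ 2 / (2 * σ) < η →
    ∀ᶠ n in atTop, Real.exp (-(η * a n)) ≤ 1 - F n x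

/-- Head sums inherit moderate deviations from the surprisals. -/
lemma GaussianMGFLimit.moderateCDF_headSum {α : ℕ → Type*} [∀ n, Fintype (α n)]
    {w : ∀ n, α n → ℝ} {C t : ℕ → ℝ} {σ : ℝ} (hw : ∀ n, IsProbDist (w n)) (ht : ModerateSeq t)
    (h : GaussianMGFLimit w (fun n i => t n * (-Real.log (w n i) - C n))
      (fun n => (n : ℝ) * t n ^ 2) σ) :
    ModerateCDF (fun n x => headSum (w n) (Real.exp (C n + x * (n * t n))))
      (fun n => (n : ℝ) * t n ^ 2) σ := by
  have hσ := h.var_pos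
  have hge : ∀ n, 0 < t n → ∀ x i, (x * ((n : ℝ) * t n ^ 2) ≤ t n * (-Real.log (w n i) - C n)) ↔
      C n + x * (n * t n) ≤ -Real.log (w n i) := by
    intro n htn x i
    rw [show x * ((n : ℝ) * t n ^ 2) = t n * (x * (n * t n)) by ring, mul_le_mul_iff_right₀ htn]
    constructor <;> intro h <;> linarith
  have hle : ∀ n, 0 < t n → ∀ x i,
      (-x * ((n : ℝ) * t n ^ 2) ≤ -(t n * (-Real.log (w n i) - C n))) ↔
      -Real.log (w n i) ≤ C n + x * (n * t n) := by
    intro n htn x i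
    rw [show -x * ((n : ℝ) * t n ^ 2) = -(t n * (x * (n * t n))) by ring, neg_le_neg_iff,
      mul_le_mul_iff_right₀ htn]
    constructor <;> intro h <;> linarith
  have hcont : ∀ x : ℝ, ContinuousAt (fun y : ℝ => y ^ 2 / (2 * σ)) x := fun x => by fun_prop
  refine ⟨hσ, h.speed, ?_, fun n x => headSum_nonneg (hw n).1 _, fun n x => headSum_le_one (hw n) _,
    fun x η hx hη => ?_, fun x η hx hη => ?_, fun x η hx hη => ?_, fun x η hx hη => ?_⟩
  · filter_upwards [ht.eventually_pos] with n htn x y hxy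
    refine headSum_mono (hw n).1 (Real.exp_le_exp.2 ?_)
    have : 0 ≤ (n : ℝ) * t n := mul_nonneg (Nat.cast_nonneg n) htn.le
    linarith [mul_le_mul_of_nonneg_right hxy this]
  · have hev : ∀ᶠ y in 𝓝[>] x, η < y ^ 2 / (2 * σ) ∧ y < 0 :=
      (((hcont x).eventually_const_lt hη).and (eventually_lt_nhds hx)).filter_mono
        nhdsWithin_le_nhds
    obtain ⟨y, ⟨hy1, hy2⟩, hxy⟩ := (hev.and self_mem_nhdsWithin).exists
    obtain ⟨η', hη1, hη2⟩ := exists_between hy1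
    filter_upwards [h.neg.tail_le (x := -y) (η := η') (by linarith) (by simpa using hη2),
      ht.eventually_exp_le (sub_pos.2 hxy) η', eventually_two_mul_exp_lt h.speed hη1,
      ht.eventually_pos] with n h1 h2 h3 htn
    simp only [hle n htn] at h1
    have h4 := headSum_exp_le (hw n) (C n + x * (n * t n)) ((y - x) * (n * t n))
    rw [show C n + x * (n * t n) + (y - x) * (n * t n) = C n + y * (n * t n) by ring] at h4
    have h5 : ∑ i ∈ Finset.univ.filter (fun i => -Real.log (w n i) < C n + y * (n * t n)), w n i
        ≤ ∑ i ∈ Finset.univ.filter (fun i => -Real.log (w n i) ≤ C n + y * (n * t n)), w n i := by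
      refine Finset.sum_le_sum_of_subset_of_nonneg (fun i hi => ?_) fun i _ _ => (hw n).1 i
      simp only [Finset.mem_filter, Finset.mem_univ, true_and] at hi ⊢
      exact hi.le
    linarith
  · filter_upwards [h.neg.le_tail (x := -x) (η := η) (by linarith) (by simpa using hη),
      ht.eventually_pos] with n h1 htn
    simp only [hle n htn] at h1
    exact h1.trans (sum_le_headSum_exp (hw n) _)
  · filter_upwards [h.tail_le hx.le hη, ht.eventually_pos] with n h1 htn
    simp only [hge n htn] at h1
    exact (one_sub_headSum_exp_le (hw n) _).trans h1
  · have hev : ∀ᶠ y in 𝓝[>] x, y ^ 2 / (2 * σ) < η :=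
      ((hcont x).eventually_lt_const hη).filter_mono nhdsWithin_le_nhds
    obtain ⟨y, hy1, hxy⟩ := (hev.and self_mem_nhdsWithin).exists
    obtain ⟨η', hη1, hη2⟩ := exists_between hy1
    have hxy' : x < y := hxy
    filter_upwards [h.le_tail (x := y) (by linarith) hη1, ht.eventually_exp_le (sub_pos.2 hxy) η,
      eventually_two_mul_exp_lt h.speed hη2, ht.eventually_pos] with n h1 h2 h3 htn
    simp only [hge n htn] at h1
    have h4 := le_one_sub_headSum_exp (hw n) (C n + x * (n * t n)) ((y - x) * (n * t n))
    rw [show C n + x * (n * t n) + (y - x) * (n * t n) = C n + y * (n * t n) by ring] at h4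
    linarith

namespace ModerateCDF

variable {F G : ℕ → ℝ → ℝ} {a : ℕ → ℝ} {A B : ℝ}

lemma exists_nhds_le (hF : ModerateCDF F a A) (hG : ModerateCDF G a B) {r : ℝ} (hr : 0 < r)
    (h1 : √(2 * A) - √(2 * B) < r) (h2 : √(2 * B) - √(2 * A) < r) (x : ℝ) :
    ∃ δ > 0, ∀ᶠ n in atTop, F n (x + δ) ≤ G n (x - δ + r) + Real.exp (-a n) := by
  have hA := hF.var_pos
  have hB := hG.var_pos
  set α := √(2 * A) with hα
  set β := √(2 * B) with hβ
  have hα0 : 0 < α := Real.sqrt_pos.2 (by linarith)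
  have hβ0 : 0 < β := Real.sqrt_pos.2 (by linarith)
  have hαA : 2 * A = α ^ 2 := (Real.sq_sqrt (by linarith)).symm
  have hβB : 2 * B = β ^ 2 := (Real.sq_sqrt (by linarith)).symm
  have cF : ContinuousAt (fun δ : ℝ => (x + δ) ^ 2 / (2 * A)) 0 := by fun_prop
  have cG : ContinuousAt (fun δ : ℝ => (x - δ + r) ^ 2 / (2 * B)) 0 := by fun_prop
  have lF : ContinuousAt (fun δ : ℝ => x + δ) 0 := by fun_prop
  have lG : ContinuousAt (fun δ : ℝ => x - δ + r) 0 := by fun_prop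
  have pick : ∀ {P : ℝ → Prop}, (∀ᶠ δ in 𝓝 0, P δ) → ∃ δ > 0, P δ := by
    intro P hP
    have hP' : ∀ᶠ δ in 𝓝[>] (0 : ℝ), P δ := hP.filter_mono nhdsWithin_le_nhds
    obtain ⟨δ, h1, h2⟩ := (hP'.and self_mem_nhdsWithin).exists
    exact ⟨δ, h2, h1⟩
  rcases le_or_gt x (-r) with hxr | hxr
  · by_cases hx : x < -α
    · obtain ⟨δ, hδ, hδ1, hδ2⟩ := pick ((cF.eventually_const_lt (u := 1) (by
        rw [hαA, lt_div_iff₀ (by positivity)]; nlinarith)).and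
        (lF.eventually_lt_const (u := 0) (by linarith)))
      refine ⟨δ, hδ, ?_⟩
      filter_upwards [hF.lower_le _ 1 hδ2 hδ1] with n hn
      rw [one_mul] at hn
      linarith [hG.nonneg n (x - δ + r)]
    · obtain ⟨δ, hδ, hδ1, hδ2⟩ := pick ((cG.eventually_lt cF (by
        rw [hαA, hβB]
        simp only [sub_zero, add_zero]
        rw [← div_pow, ← div_pow, ← neg_sq (x / α), ← neg_sq ((x + r) / β)]
        have e : -((x + r) / β) < -(x / α) := by
          rw [neg_lt_neg_iff, div_lt_div_iff₀ hα0 hβ0]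
          nlinarith
        refine pow_lt_pow_left₀ e ?_ two_ne_zero
        rw [← neg_div]
        exact div_nonneg (by linarith) hβ0.le)).and
        (lF.eventually_lt_const (u := 0) (by linarith)))
      obtain ⟨η, hη1, hη2⟩ := exists_between hδ1
      refine ⟨δ, hδ, ?_⟩
      filter_upwards [hF.lower_le _ η hδ2 hη2, hG.le_lower _ η (by linarith) hη1] with n hn hn'
      linarith [Real.exp_pos (-a n)]
  · rcases lt_or_ge x 0 with hx0 | hx0
    · obtain ⟨δ, hδ, hδ1, hδ2⟩ := pick ((lF.eventually_lt_const (u := 0) (by linarith)).and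
        (lG.eventually_const_lt (u := 0) (by linarith)))
      have e1 : 0 < (x + δ) ^ 2 / (2 * A) := div_pos (by nlinarith) (by linarith)
      have e2 : 0 < (x - δ + r) ^ 2 / (2 * B) := div_pos (by nlinarith) (by linarith)
      obtain ⟨η, hη1, hη2⟩ := exists_between (lt_min e1 e2)
      refine ⟨δ, hδ, ?_⟩
      filter_upwards [hF.lower_le _ η hδ1 (hη2.trans_le (min_le_left _ _)),
        hG.upper_le _ η hδ2 (hη2.trans_le (min_le_right _ _)),
        eventually_two_mul_exp_lt hF.speed hη1] with n hn hn' hn''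
      rw [zero_mul, neg_zero, Real.exp_zero] at hn''
      linarith [Real.exp_pos (-a n)]
    · by_cases hx : β - r < x
      · obtain ⟨δ, hδ, hδ1, hδ2⟩ := pick ((cG.eventually_const_lt (u := 1) (by
          rw [hβB, lt_div_iff₀ (by positivity)]; nlinarith)).and
          (lG.eventually_const_lt (u := 0) (by linarith)))
        refine ⟨δ, hδ, ?_⟩
        filter_upwards [hG.upper_le _ 1 hδ2 hδ1] with n hn
        rw [one_mul] at hn
        linarith [hF.le_one n (x + δ)]
      · obtain ⟨δ, hδ, hδ1, hδ2⟩ := pick ((cF.eventually_lt cG (by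
          rw [hαA, hβB]
          simp only [sub_zero, add_zero]
          rw [← div_pow, ← div_pow]
          have e : x / α < (x + r) / β := by
            rw [div_lt_div_iff₀ hα0 hβ0]
            nlinarith
          exact pow_lt_pow_left₀ e (div_nonneg hx0 hα0.le) two_ne_zero)).and
          (lG.eventually_const_lt (u := 0) (by linarith)))
        obtain ⟨η, hη1, hη2⟩ := exists_between hδ1
        refine ⟨δ, hδ, ?_⟩
        filter_upwards [hF.le_upper _ η (by linarith) hη1, hG.upper_le _ η hδ2 hη2] with n hn hn'
        linarith [Real.exp_pos (-a n)]

/-- A sufficiently large shift makes `G` dominate `F` uniformly, up to error `exp (-a n)`. -/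
lemma eventually_forall_le (hF : ModerateCDF F a A) (hG : ModerateCDF G a B) {r : ℝ} (hr : 0 < r)
    (h1 : √(2 * A) - √(2 * B) < r) (h2 : √(2 * B) - √(2 * A) < r) :
    ∀ᶠ n in atTop, ∀ x, F n x ≤ G n (x + r) + Real.exp (-a n) := by
  have hA := hF.var_pos
  have hB := hG.var_pos
  have large : ∀ σ : ℝ, 0 < σ → ∃ L > 0, 1 < L ^ 2 / (2 * σ) := fun σ hσ => by
    refine ⟨2 * σ + 1, by linarith, ?_⟩
    rw [lt_div_iff₀ (by linarith)]
    nlinarith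
  obtain ⟨L₁, hL₁, hL₁'⟩ := large A hA
  obtain ⟨L₂, hL₂, hL₂'⟩ := large B hB
  have hcomp : ∀ᶠ n in atTop, ∀ x ∈ Set.Icc (-L₁) L₂, F n x ≤ G n (x + r) + Real.exp (-a n) := by
    refine isCompact_Icc.induction_on
      (p := fun s => ∀ᶠ n in atTop, ∀ x ∈ s, F n x ≤ G n (x + r) + Real.exp (-a n))
      (by simp) (fun s s' hs h => h.mono fun n hn x hx => hn x (hs hx))
      (fun s s' h h' => ?_) fun x _ => ?_
    · filter_upwards [h, h'] with n hn hn' x hx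
      exact hx.elim (hn x) (hn' x)
    · obtain ⟨δ, hδ, hev⟩ := exists_nhds_le hF hG hr h1 h2 x
      refine ⟨Set.Icc (x - δ) (x + δ),
        mem_nhdsWithin_of_mem_nhds (Icc_mem_nhds (by linarith) (by linarith)), ?_⟩
      filter_upwards [hev, hF.mono, hG.mono] with n hn mF mG y hy
      have e1 := mF hy.2
      have e2 := mG (show x - δ + r ≤ y + r by linarith [hy.1])
      linarith
  filter_upwards [hcomp, hF.lower_le (-L₁) 1 (by linarith) (by simpa using hL₁'),
    hG.upper_le L₂ 1 hL₂ hL₂', hF.mono, hG.mono] with n hn hl hu mF mG x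
  rw [one_mul] at hl hu
  rcases lt_or_ge x (-L₁) with hx | hx
  · linarith [mF hx.le, hG.nonneg n (x + r)]
  · rcases le_or_gt x L₂ with hx' | hx'
    · exact hn x ⟨hx, hx'⟩
    · linarith [mG (show L₂ ≤ x + r by linarith), hF.le_one n x]

/-- If the shift is too small, then `G` fails to dominate `F` up to error `exp (-a n)`. -/
lemma exists_eventually_lt (hF : ModerateCDF F a A) (hG : ModerateCDF G a B) {r : ℝ}
    (h : r < |√(2 * A) - √(2 * B)|) :
    ∃ x, ∀ᶠ n in atTop, G n (x + r) + Real.exp (-a n) < F n x := by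
  have hA := hF.var_pos
  have hB := hG.var_pos
  set α := √(2 * A) with hα
  set β := √(2 * B) with hβ
  have hα0 : 0 < α := Real.sqrt_pos.2 (by linarith)
  have hβ0 : 0 < β := Real.sqrt_pos.2 (by linarith)
  have hαA : 2 * A = α ^ 2 := (Real.sq_sqrt (by linarith)).symm
  have hβB : 2 * B = β ^ 2 := (Real.sq_sqrt (by linarith)).symm
  rcases lt_abs.1 h with h | h
  · obtain ⟨x, hx1, hx2⟩ := exists_between (show -α < -β - r by linarith)
    have e1 : (min x 0) ^ 2 / (2 * A) < 1 := by
      rw [hαA, div_lt_one (by positivity)]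
      exact sq_lt_sq' (lt_min (by linarith) (by linarith)) ((min_le_right _ _).trans_lt hα0)
    have e2 : 1 < (x + r) ^ 2 / (2 * B) := by
      rw [hβB, one_lt_div (by positivity)]
      nlinarith
    obtain ⟨η, hη1, hη2⟩ := exists_between e1
    refine ⟨x, ?_⟩
    filter_upwards [hF.le_lower _ η (min_le_right _ _) hη1, hG.lower_le _ 1 (by linarith) e2,
      eventually_two_mul_exp_lt hF.speed hη2, hF.mono] with n n1 n2 n3 mF
    rw [one_mul] at n2 n3
    linarith [mF (min_le_left x 0)]
  · obtain ⟨x, hx1, hx2⟩ := exists_between (show α < β - r by linarith)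
    have e1 : (max (x + r) 0) ^ 2 / (2 * B) < 1 := by
      rw [hβB, div_lt_one (by positivity)]
      exact pow_lt_pow_left₀ (max_lt (by linarith) hβ0) (le_max_right _ _) two_ne_zero
    have e2 : 1 < x ^ 2 / (2 * A) := by
      rw [hαA, one_lt_div (by positivity)]
      nlinarith
    obtain ⟨η, hη1, hη2⟩ := exists_between e1
    refine ⟨x, ?_⟩
    filter_upwards [hG.le_upper _ η (le_max_right _ _) hη1, hF.upper_le _ 1 (by linarith) e2,
      eventually_two_mul_exp_lt hF.speed hη2, hG.mono] with n n1 n2 n3 mG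
    rw [one_mul] at n2 n3
    linarith [mG (le_max_left (x + r) 0)]

end ModerateCDF

/-- Conversion to a tensor power, in terms of head sums; sharp ancillas play no role. -/
lemma approxSubMajTV_tpow_iff {α β γ : Type*} [Fintype α] [Fintype β] [Fintype γ]
    {p : α → ℝ} {q : β → ℝ} {s : γ → ℝ} (hp : IsProbDist p) (hq : IsProbDist q)
    (hs : IsProbDist s) (hsharp : IsSharp s) (n m : ℕ) {ε : ℝ} (hε : 0 ≤ ε) :
    ApproxSubMajTV (tensor (tpow p n) (tpow s m)) (tensor (tpow q m) (tpow s n)) ε ↔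
      ∀ k : ℕ, headSum (tpow p n) (k : ℝ) ≤ headSum (tpow q m) (k : ℝ) + ε := by
  rw [approxSubMajTV_iff ((hp.tpow n).tensor (hs.tpow m)) ((hq.tpow m).tensor (hs.tpow n)) hε]
  refine forall_congr' fun k => ?_
  rw [headSum_tensor_sharp (hp.tpow n).1 (hsharp.tpow m) (Nat.cast_nonneg k),
    headSum_tensor_sharp (hq.tpow m).1 (hsharp.tpow n) (Nat.cast_nonneg k)]

/-- Moderate deviations of the head sums of `q^{⊗m n}`, where `m n` is chosen so that its total
entropy is `n H - r n t` up to a bounded error. -/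
lemma moderateCDF_headSum_tpow {β : Type*} [Fintype β] {q : β → ℝ} (hq : IsProbDist q)
    (hH : 0 < shannonH q) (hV : 0 < entV q) {t : ℕ → ℝ} (ht : ModerateSeq t) {H : ℝ} (hH' : 0 < H)
    {r : ℝ} {m : ℕ → ℕ}
    (hm : ∀ᶠ n : ℕ in atTop, |m n * shannonH q - (n * H - r * (n * t n))| ≤ shannonH q) :
    ModerateCDF
      (fun n x => headSum (tpow q (m n)) (Real.exp ((n * H - r * (n * t n)) + x * (n * t n))))
      (fun n => (n : ℝ) * t n ^ 2) (H / shannonH q * entV q) := by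
  refine GaussianMGFLimit.moderateCDF_headSum (fun n => hq.tpow _) ht
    (gaussianMGFLimit_tpow hq hV ht (div_pos hH' hH) ?_ ?_)
  · have h1 : Tendsto (fun n : ℕ => (m n * shannonH q - (n * H - r * (n * t n))) / n) atTop
        (𝓝 0) := by
      refine squeeze_zero_norm' (a := fun n : ℕ => shannonH q / n) ?_
        (tendsto_const_nhds.div_atTop tendsto_natCast_atTop_atTop)
      filter_upwards [hm] with n hn
      rw [Real.norm_eq_abs, abs_div, Nat.abs_cast]
      exact div_le_div_of_nonneg_right hn (Nat.cast_nonneg n)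
    have h2 := (((h1.add_const H).sub (ht.1.const_mul r)).div_const (shannonH q))
    simp only [zero_add, mul_zero, sub_zero] at h2
    refine h2.congr' ?_
    filter_upwards [eventually_gt_atTop 0] with n hn
    have hn' : (n : ℝ) ≠ 0 := by exact_mod_cast hn.ne'
    field_simp
    ring
  · refine squeeze_zero_norm' (a := fun n : ℕ => shannonH q / (n * t n)) ?_
      (tendsto_const_nhds.div_atTop ht.tendsto_mul)
    filter_upwards [hm, ht.eventually_pos] with n hn htn
    have : 0 ≤ (n : ℝ) * t n := mul_nonneg (Nat.cast_nonneg n) htn.le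
    rw [Real.norm_eq_abs, abs_div, abs_of_nonneg this]
    exact div_le_div_of_nonneg_right hn this

lemma ModerateSeq.eventually_entropy_nonneg {t : ℕ → ℝ} (ht : ModerateSeq t) {H : ℝ} (hH : 0 < H)
    (r : ℝ) : ∀ᶠ n : ℕ in atTop, 0 ≤ n * H - r * (n * t n) := by
  have h1 : Tendsto (fun n => r * t n) atTop (𝓝 0) := by simpa using ht.1.const_mul r
  filter_upwards [h1.eventually_lt_const hH] with n hn
  have : (n : ℝ) * H - r * (n * t n) = n * (H - r * t n) := by ring
  rw [this]
  exact mul_nonneg (Nat.cast_nonneg n) (by linarith)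

section Conversion

variable {α β : Type*} [Fintype α] [Fintype β] {p : α → ℝ} {q : β → ℝ} {t : ℕ → ℝ}

lemma eventually_headSum_tpow_le (hp : IsProbDist p) (hq : IsProbDist q)
    (hHp : 0 < shannonH p) (hHq : 0 < shannonH q) (hVp : 0 < entV p) (hVq : 0 < entV q)
    (ht : ModerateSeq t) {r : ℝ}
    (hr : |√(2 * entV p) - √(2 * (shannonH p / shannonH q * entV q))| < r) :
    ∀ᶠ n : ℕ in atTop, ∀ k : ℕ, headSum (tpow p n) (k : ℝ)
      ≤ headSum (tpow q ⌊(n * shannonH p - r * (n * t n)) / shannonH q⌋₊) (k : ℝ)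
        + Real.exp (-(n * t n ^ 2)) := by
  have hF := moderateCDF_headSum_tpow hp hHp hVp ht hHp (r := 0) (m := fun n => n)
    (Eventually.of_forall fun n => by simpa using hHp.le)
  rw [div_self hHp.ne', one_mul] at hF
  have hG := moderateCDF_headSum_tpow hq hHq hVq ht hHp (r := r)
    (m := fun n => ⌊(n * shannonH p - r * (n * t n)) / shannonH q⌋₊) (by
      filter_upwards [ht.eventually_entropy_nonneg hHp r] with n hn
      have h1 := Nat.floor_le (div_nonneg hn hHq.le)
      have h2 := Nat.lt_floor_add_one ((n * shannonH p - r * (n * t n)) / shannonH q)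
      rw [le_div_iff₀ hHq] at h1
      rw [div_lt_iff₀ hHq] at h2
      rw [abs_le]
      constructor <;> linarith)
  have hr0 : 0 < r := (abs_nonneg _).trans_lt hr
  have hr1 := abs_lt.1 hr
  filter_upwards [hF.eventually_forall_le hG hr0 hr1.2 (by linarith), ht.eventually_pos,
    eventually_gt_atTop 0] with n hn htn hn0 k
  rcases Nat.eq_zero_or_pos k with hk | hk
  · subst hk
    rw [Nat.cast_zero, headSum_zero, headSum_zero, zero_add]
    exact (Real.exp_pos _).le
  · have hk' : (0 : ℝ) < k := by exact_mod_cast hk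
    have hnt : (n : ℝ) * t n ≠ 0 := (mul_pos (by exact_mod_cast hn0) htn).ne'
    have h := hn ((Real.log k - n * shannonH p) / (n * t n))
    have e1 : (n * shannonH p - 0 * (n * t n))
        + (Real.log k - n * shannonH p) / (n * t n) * (n * t n) = Real.log k := by
      rw [div_mul_cancel₀ _ hnt]; ring
    have e2 : (n * shannonH p - r * (n * t n))
        + ((Real.log k - n * shannonH p) / (n * t n) + r) * (n * t n) = Real.log k := by
      rw [add_mul, div_mul_cancel₀ _ hnt]; ring
    rwa [e1, e2, Real.exp_log hk'] at h

lemma eventually_exists_lt_headSum_tpow (hp : IsProbDist p) (hq : IsProbDist q)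
    (hHp : 0 < shannonH p) (hHq : 0 < shannonH q) (hVp : 0 < entV p) (hVq : 0 < entV q)
    (ht : ModerateSeq t) {r : ℝ}
    (hr : r < |√(2 * entV p) - √(2 * (shannonH p / shannonH q * entV q))|) :
    ∀ᶠ n : ℕ in atTop, ∃ k : ℕ,
      headSum (tpow q ⌈(n * shannonH p - r * (n * t n)) / shannonH q⌉₊) (k : ℝ)
        + Real.exp (-(n * t n ^ 2)) < headSum (tpow p n) (k : ℝ) := by
  have hF := moderateCDF_headSum_tpow hp hHp hVp ht hHp (r := 0) (m := fun n => n)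
    (Eventually.of_forall fun n => by simpa using hHp.le)
  rw [div_self hHp.ne', one_mul] at hF
  have hG := moderateCDF_headSum_tpow hq hHq hVq ht hHp (r := r)
    (m := fun n => ⌈(n * shannonH p - r * (n * t n)) / shannonH q⌉₊) (by
      filter_upwards [ht.eventually_entropy_nonneg hHp r] with n hn
      have h1 := Nat.le_ceil ((n * shannonH p - r * (n * t n)) / shannonH q)
      have h2 := Nat.ceil_lt_add_one (div_nonneg hn hHq.le)
      rw [div_le_iff₀ hHq] at h1
      rw [← sub_lt_iff_lt_add, lt_div_iff₀ hHq] at h2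
      rw [abs_le]
      constructor <;> linarith)
  obtain ⟨x, hx⟩ := hF.exists_eventually_lt hG hr
  filter_upwards [hx] with n hn
  refine ⟨⌊Real.exp (n * shannonH p + x * (n * t n))⌋₊, ?_⟩
  rw [← headSum_floor _ (Real.exp_pos _).le, ← headSum_floor _ (Real.exp_pos _).le]
  have e1 : (n * shannonH p - r * (n * t n)) + (x + r) * (n * t n)
      = n * shannonH p + x * (n * t n) := by ring
  have e2 : (n * shannonH p - 0 * (n * t n)) + x * (n * t n)
      = n * shannonH p + x * (n * t n) := by ring
  rwa [e1, e2] at hn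

end Conversion

/-- Moderate deviation expansion of the optimal entanglement-direction conversion rate
(total variation error, vanishing error `ε_n = e^{-n t_n²}`). -/
theorem entanglement_direction_moderate_deviation
    {dp dq ds : ℕ} (p : Fin dp → ℝ) (q : Fin dq → ℝ) (s : Fin ds → ℝ)
    (hp : IsProbDist p) (hq : IsProbDist q)
    (hs : IsProbDist s) (hsharp : IsSharp s)
    (hHp : 0 < shannonH p) (hHq : 0 < shannonH q)
    (hVp : 0 < entV p) (hVq : 0 < entV q)
    (t : ℕ → ℝ) (ht : ModerateSeq t)
    (ε : ℕ → ℝ) (hε : ∀ n : ℕ, ε n = Real.exp (-((n : ℝ) * t n ^ 2)))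
    (R : ℕ → ℝ → ℝ)
    (hR : ∀ n : ℕ, ∀ e : ℝ, 0 ≤ e → R n e =
      (↑(sSup {m : ℕ | ApproxSubMajTV (tensor (tpow p n) (tpow s m))
          (tensor (tpow q m) (tpow s n)) e}) : ℝ) / (n : ℝ))
    (ν : ℝ) (hν : ν = (entV p / shannonH p) / (entV q / shannonH q)) :
    Tendsto (fun n : ℕ => (R n (ε n) - shannonH p / shannonH q) / t n) atTop
      (𝓝 (-(Real.sqrt (2 * entV p) / shannonH q) * |1 - 1 / Real.sqrt ν|)) := by
  set κ := shannonH p / shannonH q with hκ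
  set r₀ := |√(2 * entV p) - √(2 * (κ * entV q))| with hr₀
  set M : ℕ → ℕ := fun n => sSup {m : ℕ | ApproxSubMajTV (tensor (tpow p n) (tpow s m))
          (tensor (tpow q m) (tpow s n)) (ε n)} with hM
  have hε0 : ∀ n, 0 ≤ ε n := fun n => by rw [hε]; exact (Real.exp_pos _).le
  have hR' : ∀ n, R n (ε n) = (M n : ℝ) / n := fun n => hR n _ (hε0 n)
  have hupper : ∀ r < r₀, ∀ᶠ n : ℕ in atTop, ∀ m : ℕ,
      ApproxSubMajTV (tensor (tpow p n) (tpow s m)) (tensor (tpow q m) (tpow s n)) (ε n) →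
      m ≤ ⌈(n * shannonH p - r * (n * t n)) / shannonH q⌉₊ := by
    intro r hr
    filter_upwards [eventually_exists_lt_headSum_tpow hp hq hHp hHq hVp hVq ht hr] with n hn m hm
    obtain ⟨k, hk⟩ := hn
    rw [approxSubMajTV_tpow_iff hp hq hs hsharp n m (hε0 n), hε] at hm
    by_contra! hlt
    have h1 := headSum_tpow_antitone hq (Nat.cast_nonneg (α := ℝ) k) hlt.le
    have h2 := hm k
    simp only at h1
    linarith
  have hMle : ∀ r < r₀, ∀ᶠ n : ℕ in atTop,
      (M n : ℝ) ≤ (n * shannonH p - r * (n * t n)) / shannonH q + 1 := by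
    intro r hr
    filter_upwards [hupper r hr, ht.eventually_entropy_nonneg hHp r] with n hn hn'
    have h1 : M n ≤ ⌈(n * shannonH p - r * (n * t n)) / shannonH q⌉₊ := csSup_le' hn
    exact le_trans (by exact_mod_cast h1) (Nat.ceil_lt_add_one (div_nonneg hn' hHq.le)).le
  have hleM : ∀ r, r₀ < r → ∀ᶠ n : ℕ in atTop,
      (n * shannonH p - r * (n * t n)) / shannonH q - 1 ≤ (M n : ℝ) := by
    intro r hr
    filter_upwards [eventually_headSum_tpow_le hp hq hHp hHq hVp hVq ht hr,
      hupper (r₀ - 1) (by linarith)] with n hn hb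
    have h1 : ⌊(n * shannonH p - r * (n * t n)) / shannonH q⌋₊ ≤ M n := by
      refine le_csSup ⟨_, hb⟩ ?_
      change ApproxSubMajTV _ _ _
      rwa [approxSubMajTV_tpow_iff hp hq hs hsharp n _ (hε0 n), hε]
    have h2 := Nat.lt_floor_add_one ((n * shannonH p - r * (n * t n)) / shannonH q)
    have h3 : ((⌊(n * shannonH p - r * (n * t n)) / shannonH q⌋₊ : ℕ) : ℝ) ≤ M n := by
      exact_mod_cast h1
    linarith
  have hL : -(Real.sqrt (2 * entV p) / shannonH q) * |1 - 1 / Real.sqrt ν|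
      = -(r₀ / shannonH q) := by
    have hν0 : 0 < ν := by rw [hν]; positivity
    have e : 2 * (κ * entV q) = 2 * entV p / ν := by
      rw [hν, hκ]
      field_simp
    rw [hr₀, e, Real.sqrt_div (by linarith), show √(2 * entV p) - √(2 * entV p) / √ν
      = √(2 * entV p) * (1 - 1 / √ν) by ring, abs_mul, abs_of_nonneg (Real.sqrt_nonneg _)]
    ring
  have hinv : Tendsto (fun n : ℕ => 1 / ((n : ℝ) * t n)) atTop (𝓝 0) :=
    tendsto_const_nhds.div_atTop ht.tendsto_mul
  have hrate : ∀ r c : ℝ, ∀ n : ℕ, 0 < n → 0 < t n →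
      (((n * shannonH p - r * (n * t n)) / shannonH q + c) / n - κ) / t n
        = -(r / shannonH q) + c * (1 / (n * t n)) := by
    intro r c n hn htn
    have hn' : (n : ℝ) ≠ 0 := by exact_mod_cast hn.ne'
    rw [hκ]
    field_simp
    ring
  have hmono : ∀ x y : ℝ, x ≤ y → ∀ n : ℕ, 0 < t n → (x / n - κ) / t n ≤ (y / n - κ) / t n := by
    intro x y hxy n htn
    refine div_le_div_of_nonneg_right (sub_le_sub_right ?_ _) htn.le
    exact div_le_div_of_nonneg_right hxy (Nat.cast_nonneg n)
  simp only [hR', hL]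
  refine tendsto_order.2 ⟨fun l hl => ?_, fun u hu => ?_⟩
  · obtain ⟨r, hr1, hr2⟩ := exists_between (show r₀ < -l * shannonH q by
      rw [← div_lt_iff₀ hHq]; linarith)
    rw [← div_lt_iff₀ hHq] at hr2
    have hlim := (hinv.const_mul (-1)).const_add (-(r / shannonH q))
    rw [mul_zero, add_zero] at hlim
    filter_upwards [hleM r hr1, hlim.eventually_const_lt (show l < _ by linarith),
      ht.eventually_pos, eventually_gt_atTop 0] with n h1 h2 htn hn
    rw [← hrate r (-1) n hn htn] at h2
    exact h2.trans_le (hmono _ _ (by linarith) n htn)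
  · obtain ⟨r, hr1, hr2⟩ := exists_between (show -u * shannonH q < r₀ by
      rw [← lt_div_iff₀ hHq]; linarith)
    rw [← lt_div_iff₀ hHq] at hr1
    have hlim := (hinv.const_mul 1).const_add (-(r / shannonH q))
    rw [mul_zero, add_zero] at hlim
    filter_upwards [hMle r hr2, hlim.eventually_lt_const (show _ < u by linarith),
      ht.eventually_pos, eventually_gt_atTop 0] with n h1 h2 htn hn
    rw [← hrate r 1 n hn htn] at h2
    exact (hmono _ _ h1 n htn).trans_lt h2
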